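/- arXiv:1904.10385 — 2 statements merged into one kernel-verified Lean document; each statement's English description precedes it below -/
import Mathlib

section
/- For all integers n ≥ 0 and all t, s ≥ 0: Sₙ(t+s) = Σ_{k=0}^{n} Sₖ(t) ∘ S_{n−k}(s) in L(X₀). -/
open Set Filter MeasureTheory
open scoped Topology

noncomputable section

structure MRSetting (X : Type*) [NormedAddCommGroup X] [NormedSpace ℂ X] [CompleteSpace X]
    (X₀ : Submodule ℂ X) where
  closed : IsClosed (X₀ : Set X)
  T : ℝ → (X₀ →L[ℂ] X₀)
  S : ℝ → (X →L[ℂ] X₀)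
  T_zero : T 0 = 1
  T_add : ∀ t s : ℝ, 0 ≤ t → 0 ≤ s → T (t + s) = (T t).comp (T s)
  T_cont : ∀ x : X₀, ContinuousOn (fun t => T t x) (Ici 0)
  S_zero : S 0 = 0
  S_cont : ∀ x : X, ContinuousOn (fun t => S t x) (Ici 0)
  TS : ∀ t s : ℝ, 0 ≤ t → 0 ≤ s → ∀ x : X, T t (S s x) = S (t + s) x - S t x
  δ : ℝ → ℝ
  δ_nonneg : ∀ t : ℝ, 0 ≤ t → 0 ≤ δ t
  δ_mono : MonotoneOn δ (Ici 0)
  δ_lim : Tendsto δ (𝓝[>] 0) (𝓝 0)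
  SD : (ℝ → X) → ℝ → X₀
  SD_deriv : ∀ f : ℝ → X, ContinuousOn f (Ici 0) → ∀ t ∈ Ici (0:ℝ),
    HasDerivWithinAt (fun τ : ℝ => ∫ s in (0:ℝ)..τ, S (τ - s) (f s)) (SD f t) (Ici 0) t
  SD_cont : ∀ f : ℝ → X, ContinuousOn f (Ici 0) → ContinuousOn (SD f) (Ici 0)
  SD_bound : ∀ f : ℝ → X, ContinuousOn f (Ici 0) → ∀ t ∈ Ici (0:ℝ),
    ‖SD f t‖ ≤ δ t * ⨆ s : Icc (0:ℝ) t, ‖f (s : ℝ)‖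
  SDop : (ℝ → (X₀ →L[ℂ] X)) → ℝ → (X₀ →L[ℂ] X₀)
  SDop_apply : ∀ V : ℝ → (X₀ →L[ℂ] X), (∀ x : X₀, ContinuousOn (fun s => V s x) (Ici 0)) →
    ∀ t : ℝ, ∀ x : X₀, SDop V t x = SD (fun s => V s x) t

variable {X : Type*} [NormedAddCommGroup X] [NormedSpace ℂ X] [CompleteSpace X]
  {X₀ : Submodule ℂ X}

/-- The perturbation operator `B(U) = S ⋄ (L ∘ U)`. -/
def MRSetting.Bop (M : MRSetting X X₀) (L : X₀ →L[ℂ] X) (U : ℝ → (X₀ →L[ℂ] X₀)) :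
    ℝ → (X₀ →L[ℂ] X₀) :=
  M.SDop (fun s => L.comp (U s))


theorem MRSetting.cont_aux (M : MRSetting X X₀) (f : ℝ → X) (hf : ContinuousOn f (Ici 0))
    (τ b : ℝ) (hb : b ≤ τ) :
    ContinuousOn (fun r => M.S (τ - r) (f r)) (Icc 0 b) := by
  have hbd : ∃ C, ∀ i : Icc (0:ℝ) τ, ‖M.S (i : ℝ)‖ ≤ C := by
    apply banach_steinhaus
    intro x
    obtain ⟨C, hC⟩ := (isCompact_Icc (a := (0:ℝ)) (b := τ)).exists_bound_of_continuousOn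
      ((M.S_cont x).mono Icc_subset_Ici_self)
    exact ⟨C, fun i => hC i i.2⟩
  obtain ⟨C, hC⟩ := hbd
  intro r₀ hr₀
  have hf0 : Tendsto f (𝓝[Icc 0 b] r₀) (𝓝 (f r₀)) :=
    (hf r₀ hr₀.1).mono Icc_subset_Ici_self
  have h1 : Tendsto (fun r => M.S (τ - r) (f r - f r₀)) (𝓝[Icc 0 b] r₀) (𝓝 0) := by
    have h2 : Tendsto (fun r => C * ‖f r - f r₀‖) (𝓝[Icc 0 b] r₀) (𝓝 0) := by
      have := ((hf0.sub_const (f r₀)).norm).const_mul C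
      simpa using this
    refine squeeze_zero_norm' ?_ h2
    filter_upwards [self_mem_nhdsWithin] with r hr
    refine ((M.S (τ - r)).le_opNorm _).trans ?_
    gcongr
    exact hC ⟨τ - r, by linarith [hr.2], by linarith [hr.1]⟩
  have h3 : Tendsto (fun r => M.S (τ - r) (f r₀)) (𝓝[Icc 0 b] r₀)
      (𝓝 (M.S (τ - r₀) (f r₀))) := by
    have : ContinuousOn (fun r => M.S (τ - r) (f r₀)) (Icc 0 b) :=
      (M.S_cont (f r₀)).comp (f := fun r => τ - r) (by fun_prop)
        (fun r hr => by simp only [mem_Ici]; linarith [hr.2])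
    exact this r₀ hr₀
  have h4 := h1.add h3
  simp only [zero_add] at h4
  refine h4.congr ?_
  intro r
  simp

theorem MRSetting.int_aux (M : MRSetting X X₀) (f : ℝ → X) (hf : ContinuousOn f (Ici 0))
    (τ b : ℝ) (h0 : 0 ≤ b) (hb : b ≤ τ) :
    IntervalIntegrable (fun r => M.S (τ - r) (f r)) volume 0 b := by
  apply ContinuousOn.intervalIntegrable
  rw [uIcc_of_le h0]
  exact M.cont_aux f hf τ b hb

theorem MRSetting.SD_unique (M : MRSetting X X₀) (f : ℝ → X) (hf : ContinuousOn f (Ici 0))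
    (t : ℝ) (ht : 0 ≤ t) (F : ℝ → X₀) (F' : X₀) (hF : HasDerivWithinAt F F' (Ici 0) t)
    (h : ∀ τ, 0 ≤ τ → ∫ s in (0:ℝ)..τ, M.S (τ - s) (f s) = F τ) : M.SD f t = F' := by
  have h1 := M.SD_deriv f hf t ht
  have h2 := hF.congr (fun τ hτ => h τ hτ) (h t ht)
  exact (uniqueDiffOn_Ici (0:ℝ) t ht).eq_deriv _ h1 h2

theorem MRSetting.SD_congr (M : MRSetting X X₀) (f g : ℝ → X) (hf : ContinuousOn f (Ici 0))
    (hg : ContinuousOn g (Ici 0)) (h : ∀ r, 0 ≤ r → f r = g r)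
    (t : ℝ) (ht : 0 ≤ t) : M.SD f t = M.SD g t := by
  refine M.SD_unique f hf t ht _ _ (M.SD_deriv g hg t ht) ?_
  intro τ hτ
  apply intervalIntegral.integral_congr
  intro r hr
  rw [uIcc_of_le hτ] at hr
  simp only [h r hr.1]

theorem MRSetting.SD_zero (M : MRSetting X X₀) (t : ℝ) (ht : 0 ≤ t) :
    M.SD (fun _ => 0) t = 0 := by
  refine M.SD_unique _ continuousOn_const t ht _ _ (hasDerivWithinAt_const _ _ (0 : X₀)) ?_
  intro τ hτ
  simp

theorem MRSetting.SD_add (M : MRSetting X X₀) (f g : ℝ → X) (hf : ContinuousOn f (Ici 0))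
    (hg : ContinuousOn g (Ici 0))
    (t : ℝ) (ht : 0 ≤ t) : M.SD (fun r => f r + g r) t = M.SD f t + M.SD g t := by
  refine M.SD_unique _ (hf.add hg) t ht _ _
    ((M.SD_deriv f hf t ht).add (M.SD_deriv g hg t ht)) ?_
  intro τ hτ
  simp only [map_add, Pi.add_apply]
  exact intervalIntegral.integral_add (M.int_aux f hf τ τ hτ le_rfl) (M.int_aux g hg τ τ hτ le_rfl)

theorem MRSetting.SD_sum (M : MRSetting X X₀) (f : ℕ → ℝ → X)
    (hf : ∀ k, ContinuousOn (f k) (Ici 0)) (t : ℝ) (ht : 0 ≤ t) (N : ℕ) :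
    M.SD (fun r => ∑ k ∈ Finset.range N, f k r) t = ∑ k ∈ Finset.range N, M.SD (f k) t := by
  induction N with
  | zero => simpa using M.SD_zero t ht
  | succ N ih =>
    simp only [Finset.sum_range_succ]
    rw [M.SD_add _ _ (continuousOn_finsetSum _ (fun k _ => hf k)) (hf N) t ht, ih]

theorem MRSetting.SD_at_zero (M : MRSetting X X₀) (f : ℝ → X) (hf : ContinuousOn f (Ici 0)) :
    M.SD f 0 = 0 := by
  have hδ : M.δ 0 ≤ 0 := by
    refine ge_of_tendsto M.δ_lim ?_
    filter_upwards [self_mem_nhdsWithin] with t ht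
    exact M.δ_mono (mem_Ici.2 le_rfl) (mem_Ici.2 (le_of_lt ht)) (le_of_lt ht)
  have h0 : M.δ 0 = 0 := le_antisymm hδ (M.δ_nonneg 0 le_rfl)
  have := M.SD_bound f hf 0 (mem_Ici.2 le_rfl)
  rw [h0, zero_mul] at this
  exact norm_le_zero_iff.1 this

theorem shift_cont {Y : Type*} [TopologicalSpace Y] (f : ℝ → Y) (hf : ContinuousOn f (Ici 0))
    (s : ℝ) (hs : 0 ≤ s) : ContinuousOn (fun r => f (s + r)) (Ici 0) :=
  hf.comp (f := fun r => s + r) (by fun_prop)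
    (fun r hr => by simp only [mem_Ici] at *; linarith)

theorem MRSetting.F_shift (M : MRSetting X X₀) (f : ℝ → X) (hf : ContinuousOn f (Ici 0))
    (t s : ℝ) (ht : 0 ≤ t) (hs : 0 ≤ s) :
    (∫ r in (0:ℝ)..(s + t), M.S (s + t - r) (f r)) =
      M.T t (∫ r in (0:ℝ)..s, M.S (s - r) (f r)) + M.S t (∫ r in (0:ℝ)..s, f r)
      + ∫ r in (0:ℝ)..t, M.S (t - r) (f (s + r)) := by
  haveI : CompleteSpace X₀ := M.closed.completeSpace_coe
  have hfi : IntervalIntegrable f volume 0 s := by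
    apply ContinuousOn.intervalIntegrable
    rw [uIcc_of_le hs]
    exact hf.mono Icc_subset_Ici_self
  have i1 := M.int_aux f hf (s + t) s hs (by linarith)
  have i2 := M.int_aux f hf (s + t) (s + t) (by linarith) le_rfl
  have i3 := M.int_aux f hf s s hs le_rfl
  rw [← intervalIntegral.integral_add_adjacent_intervals i1 (i1.symm.trans i2)]
  congr 1
  · rw [← ContinuousLinearMap.intervalIntegral_comp_comm (M.T t) i3,
      ← ContinuousLinearMap.intervalIntegral_comp_comm (M.S t) hfi,
      ← intervalIntegral.integral_add]
    · apply intervalIntegral.integral_congr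
      intro r hr
      rw [uIcc_of_le hs] at hr
      simp only
      rw [M.TS t (s - r) ht (by linarith [hr.2])]
      rw [show t + (s - r) = s + t - r by ring]
      simp
    · exact ⟨(M.T t).integrable_comp i3.1, (M.T t).integrable_comp i3.2⟩
    · exact ⟨(M.S t).integrable_comp hfi.1, (M.S t).integrable_comp hfi.2⟩
  · have := intervalIntegral.integral_comp_add_left (a := 0) (b := t)
      (fun r => M.S (s + t - r) (f r)) s
    rw [add_zero] at this
    rw [← this]
    apply intervalIntegral.integral_congr
    intro r hr
    simp only
    rw [show s + t - (s + r) = t - r by ring]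

theorem MRSetting.SD_shift (M : MRSetting X X₀) (f : ℝ → X) (hf : ContinuousOn f (Ici 0))
    (t s : ℝ) (ht : 0 ≤ t) (hs : 0 ≤ s) :
    M.SD f (t + s) = M.T t (M.SD f s) + M.SD (fun r => f (s + r)) t := by
  have hfs := shift_cont f hf s hs
  obtain ⟨a, ha⟩ : ∃ a, a = ∫ r in (0:ℝ)..s, M.S (s - r) (f r) := ⟨_, rfl⟩
  obtain ⟨y, hy⟩ : ∃ y, y = ∫ r in (0:ℝ)..s, f r := ⟨_, rfl⟩
  let W : ℝ → X₀ := fun u => M.T u a + M.S u y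
  have hW : ∀ u, 0 ≤ u →
      HasDerivWithinAt W (M.SD f (s + u) - M.SD (fun r => f (s + r)) u) (Ici 0) u := by
    intro u hu
    have h1 := M.SD_deriv f hf (s + u) (by simp only [mem_Ici]; linarith)
    have h2 := M.SD_deriv _ hfs u hu
    have h3 : HasDerivWithinAt (fun v : ℝ => s + v) 1 (Ici 0) u :=
      (hasDerivWithinAt_id u _).const_add s
    have h4 := HasDerivWithinAt.scomp (h := fun v : ℝ => s + v) u h1 h3
      (fun v hv => by simp only [mem_Ici] at *; linarith)
    rw [one_smul] at h4
    have key : ∀ v, 0 ≤ v → W v = (∫ r in (0:ℝ)..(s + v), M.S (s + v - r) (f r)) -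
        ∫ r in (0:ℝ)..v, M.S (v - r) (f (s + r)) := by
      intro v hv
      rw [M.F_shift f hf v s hv hs, ← ha, ← hy, add_sub_cancel_right]
    exact (h4.sub h2).congr (fun v hv => key v hv) (key u hu)
  have hW0 := hW 0 le_rfl
  rw [M.SD_at_zero _ hfs, add_zero, sub_zero] at hW0
  have hWt := (hW t ht).mono (Ici_subset_Ici.2 ht)
  have h5 : HasDerivWithinAt W (M.T t (M.SD f s)) (Ici t) t := by
    have h3 : HasDerivWithinAt (fun v : ℝ => v - t) 1 (Ici t) t :=
      (hasDerivWithinAt_id t _).sub_const t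
    have h4 := HasDerivWithinAt.scomp_of_eq (h := fun v : ℝ => v - t) t hW0 h3
      (fun v hv => by simp only [mem_Ici] at *; linarith) (by simp)
    rw [one_smul] at h4
    have h6 := (((M.T t).restrictScalars ℝ).hasFDerivAt.comp_hasDerivWithinAt t h4).add_const
      (M.S t y)
    have key : ∀ v, t ≤ v → W v = M.T t (W (v - t)) + M.S t y := by
      intro v hv
      simp only [W, map_add]
      rw [M.TS t (v - t) ht (by linarith), ← ContinuousLinearMap.comp_apply,
        ← M.T_add t (v - t) ht (by linarith), add_sub_cancel]
      abel
    exact h6.congr (fun v hv => key v hv) (key t le_rfl)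
  have h7 := (uniqueDiffOn_Ici t t (mem_Ici.2 le_rfl)).eq_deriv _ hWt h5
  rw [← h7, add_comm t s]
  abel

theorem MRSetting.iter_cont (M : MRSetting X X₀) (L : X₀ →L[ℂ] X) (n : ℕ) :
    ∀ x : X₀, ContinuousOn (fun t => (M.Bop L)^[n] M.T t x) (Ici 0) := by
  induction n with
  | zero => exact M.T_cont
  | succ n ih =>
    intro x
    have hc : ∀ x : X₀, ContinuousOn (fun s => (L.comp ((M.Bop L)^[n] M.T s)) x) (Ici 0) :=
      fun x => L.continuous.comp_continuousOn (ih x)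
    simp only [Function.iterate_succ_apply', MRSetting.Bop]
    exact (M.SD_cont _ (hc x)).congr (fun t _ => M.SDop_apply _ hc t x)

theorem MRSetting.iter_succ (M : MRSetting X X₀) (L : X₀ →L[ℂ] X) (n : ℕ) (t : ℝ) (x : X₀) :
    (M.Bop L)^[n + 1] M.T t x = M.SD (fun s => L ((M.Bop L)^[n] M.T s x)) t := by
  have hc : ∀ x : X₀, ContinuousOn (fun s => (L.comp ((M.Bop L)^[n] M.T s)) x) (Ici 0) :=
    fun x => L.continuous.comp_continuousOn (M.iter_cont L n x)
  rw [Function.iterate_succ_apply']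
  exact M.SDop_apply _ hc t x


/-- the Dyson–Phillips-type identity `Sₙ(t+s) = Σ_{k=0}^{n} Sₖ(t) ∘ S_{n−k}(s)`. -/
theorem Sn_convolution (M : MRSetting X X₀) (L : X₀ →L[ℂ] X)
    (n : ℕ) (t s : ℝ) (ht : 0 ≤ t) (hs : 0 ≤ s) :
    (M.Bop L)^[n] M.T (t + s) =
      ∑ k ∈ Finset.range (n + 1), ((M.Bop L)^[k] M.T t).comp ((M.Bop L)^[n - k] M.T s) := by
  induction n generalizing t s with
  | zero => simpa using M.T_add t s ht hs
  | succ n ih =>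
    ext1 x
    have hc : ∀ (k : ℕ) (y : X₀), ContinuousOn (fun r => L ((M.Bop L)^[k] M.T r y)) (Ici 0) :=
      fun k y => L.continuous.comp_continuousOn (M.iter_cont L k y)
    rw [M.iter_succ, M.SD_shift _ (hc n x) t s ht hs, ← M.iter_succ, Finset.sum_range_succ',
      M.SD_congr (fun r => L ((M.Bop L)^[n] M.T (s + r) x))
        (fun r => ∑ k ∈ Finset.range (n + 1),
          L ((M.Bop L)^[k] M.T r ((M.Bop L)^[n - k] M.T s x)))
        (shift_cont _ (hc n x) s hs)
        (continuousOn_finsetSum _ (fun k _ => hc k _)) ?_ t ht,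
      M.SD_sum _ (fun k => hc k _) t ht, add_comm]
    · simp only [← M.iter_succ, ContinuousLinearMap.add_apply, ContinuousLinearMap.sum_apply,
        ContinuousLinearMap.comp_apply, Nat.add_sub_add_right, Nat.sub_zero,
        Function.iterate_zero, id]
    · intro r hr
      rw [add_comm s r, ih r s hr hs]
      simp only [ContinuousLinearMap.sum_apply, ContinuousLinearMap.comp_apply, map_sum]

end
end

section
/- (a) If T₀(t) is a compact operator for every t > 0, then (S ⋄ V)(t) is a compact operator for every t > 0; more generally, if L ∈ L(X₀, X) and L ∘ T₀(t) is compact for every t > 0, then L ∘ (S ⋄ V)(t) is compact for every t > 0. (b) If V is norm continuous and compact on (0,∞), then so is S ⋄ V. (c) If α, β ≥ 0, T₀ is compact on (α,∞), and V is norm continuous and compact on (β,∞), then S ⋄ V is norm continuous and compact on (α+β,∞). -/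
open Set Filter MeasureTheory
open scoped Topology

noncomputable section

variable {X : Type*} [NormedAddCommGroup X] [NormedSpace ℂ X] [CompleteSpace X]
  {X₀ : Submodule ℂ X}

section GeneralLemmas

variable {E F G : Type*} [NormedAddCommGroup E] [NormedSpace ℂ E]
  [NormedAddCommGroup F] [NormedSpace ℂ F] [NormedAddCommGroup G] [NormedSpace ℂ G]

theorem sc_bdd [CompleteSpace E] (U : ℝ → (E →L[ℂ] F))
    (hU : ∀ x : E, ContinuousOn (fun t => U t x) (Ici 0)) (a : ℝ) :
    ∃ C : ℝ, 0 < C ∧ ∀ s ∈ Icc (0:ℝ) a, ‖U s‖ ≤ C := by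
  have h : ∀ x : E, ∃ C, ∀ i : Icc (0:ℝ) a, ‖U (i : ℝ) x‖ ≤ C := by
    intro x
    obtain ⟨C, hC⟩ := (isCompact_Icc (a := (0:ℝ)) (b := a)).exists_bound_of_continuousOn
      ((hU x).mono Icc_subset_Ici_self)
    exact ⟨C, fun i => hC i i.2⟩
  obtain ⟨C, hC⟩ := banach_steinhaus h
  exact ⟨max C 1, by positivity, fun s hs => (hC ⟨s, hs⟩).trans (le_max_left _ _)⟩

theorem sc_apply [CompleteSpace E] (U : ℝ → (E →L[ℂ] F))
    (hU : ∀ x : E, ContinuousOn (fun t => U t x) (Ici 0)) (f : ℝ → E) (g : ℝ → ℝ) (s : Set ℝ)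
    (hf : ContinuousOn f s) (hg : ContinuousOn g s) (hgs : MapsTo g s (Ici 0)) :
    ContinuousOn (fun t => U (g t) (f t)) s := by
  intro t₀ ht₀
  obtain ⟨C, hC0, hC⟩ := sc_bdd U hU (g t₀ + 1)
  have h1 : Tendsto (fun t => U (g t) (f t₀)) (𝓝[s] t₀) (𝓝 (U (g t₀) (f t₀))) :=
    ((hU (f t₀)).comp hg hgs) t₀ ht₀
  have h2 : Tendsto (fun t => U (g t) (f t - f t₀)) (𝓝[s] t₀) (𝓝 0) := by
    have h3 : Tendsto (fun t => C * ‖f t - f t₀‖) (𝓝[s] t₀) (𝓝 0) := by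
      have : Tendsto (fun t => C * ‖f t - f t₀‖) (𝓝[s] t₀) (𝓝 (C * ‖f t₀ - f t₀‖)) :=
        (((hf t₀ ht₀).sub tendsto_const_nhds).norm).const_mul C
      simpa using this
    refine squeeze_zero_norm' ?_ h3
    have h4 : ∀ᶠ t in 𝓝[s] t₀, g t < g t₀ + 1 :=
      (hg t₀ ht₀).eventually_lt_const (by linarith)
    filter_upwards [h4, self_mem_nhdsWithin] with t ht hts
    exact (U (g t)).le_of_opNorm_le (hC _ ⟨hgs hts, ht.le⟩) _
  have := h2.add h1
  simp only [map_sub, sub_add_cancel, zero_add] at this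
  exact this

theorem comp_compact [CompleteSpace F] (U : ℝ → (F →L[ℂ] G))
    (hU : ∀ x : F, ContinuousOn (fun t => U t x) (Ici 0)) (K : E →L[ℂ] F)
    (hK : IsCompactOperator ⇑K) :
    ContinuousOn (fun t => (U t).comp K) (Ici 0) := by
  intro t₀ ht₀
  obtain ⟨C, hC0, hC⟩ := sc_bdd U hU (t₀ + 1)
  obtain ⟨Q, hQ, hKQ⟩ := IsCompactOperator.image_closedBall_subset_compact (f := K.toLinearMap) hK 1
  refine Metric.tendsto_nhds.2 fun ε hε => ?_
  obtain ⟨N, hNQ, hN, hcov⟩ := hQ.finite_cover_balls (e := ε / (8 * C)) (by positivity)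
  have h1 : ∀ᶠ t in 𝓝[Ici 0] t₀, ∀ y ∈ N, ‖U t y - U t₀ y‖ < ε / 4 := by
    rw [hN.eventually_all]
    intro y _
    have := Metric.tendsto_nhds.1 (hU y t₀ ht₀) (ε / 4) (by positivity)
    simpa only [dist_eq_norm] using this
  have h2 : ∀ᶠ t in 𝓝[Ici 0] t₀, t < t₀ + 1 :=
    nhdsWithin_le_nhds (Iio_mem_nhds (by linarith))
  filter_upwards [h1, h2, self_mem_nhdsWithin] with t ht ht1 ht0
  rw [dist_eq_norm]
  have hb : ‖(U t).comp K - (U t₀).comp K‖ ≤ ε / 2 := by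
    refine ContinuousLinearMap.opNorm_le_of_unit_norm (by positivity) fun z hz => ?_
    have hzQ : K z ∈ Q := hKQ ⟨z, by simp [hz], rfl⟩
    obtain ⟨y, hyN, hy⟩ := mem_iUnion₂.1 (hcov hzQ)
    rw [Metric.mem_ball, dist_eq_norm] at hy
    have e1 := (U t).le_of_opNorm_le (hC t ⟨ht0, ht1.le⟩) (K z - y)
    have e2 := (U t₀).le_of_opNorm_le (hC t₀ ⟨ht₀, by linarith⟩) (K z - y)
    have e3 : C * ‖K z - y‖ ≤ ε / 8 := by
      calc C * ‖K z - y‖ ≤ C * (ε / (8 * C)) := by gcongr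
        _ = ε / 8 := by field_simp
    have e4 := ht y hyN
    have e5 : ((U t).comp K - (U t₀).comp K) z =
        U t (K z - y) + (U t y - U t₀ y) - U t₀ (K z - y) := by
      simp only [sub_apply, ContinuousLinearMap.comp_apply, map_sub]
      abel
    rw [e5]
    have e6 := norm_sub_le (U t (K z - y) + (U t y - U t₀ y)) (U t₀ (K z - y))
    have e7 := norm_add_le (U t (K z - y)) (U t y - U t₀ y)
    linarith
  linarith

theorem bern_approx (f : C(unitInterval, E)) (e : ℝ) (he : 0 < e) :
    ∃ n : ℕ, ∀ u : unitInterval,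
      ‖f u - ∑ k : Fin (n + 1), ((bernstein n k u : ℝ) : ℂ) • f (bernstein.z k)‖ ≤ e := by
  have hB := Metric.tendsto_nhds.1 (bernsteinApproximation_uniform f) e he
  obtain ⟨n, hn⟩ := hB.exists
  refine ⟨n, fun u => ?_⟩
  have := (ContinuousMap.dist_apply_le_dist u).trans hn.le
  rw [dist_comm, dist_eq_norm, bernsteinApproximation.apply] at this
  simpa only [Complex.coe_smul] using this

theorem compact_of_approx [CompleteSpace F] (A : E →L[ℂ] F)
    (h : ∀ ε > 0, ∃ K : E →L[ℂ] F, IsCompactOperator ⇑K ∧ ‖A - K‖ ≤ ε) :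
    IsCompactOperator ⇑A := by
  have hcl := isClosed_setOfPred_isCompactOperator (σ₁₂ := RingHom.id ℂ) (M₁ := E) (M₂ := F)
  have : A ∈ closure {f : E →L[ℂ] F | IsCompactOperator ⇑f} := by
    rw [Metric.mem_closure_iff]
    intro ε hε
    obtain ⟨K, hK, hAK⟩ := h (ε / 2) (by positivity)
    exact ⟨K, hK, by rw [dist_eq_norm]; linarith⟩
  exact hcl.closure_subset this

theorem good_of_approx [CompleteSpace F] (A : ℝ → (E →L[ℂ] F)) (s : Set ℝ)
    (h : ∀ t₀ ∈ s, ∀ ε > 0, ∃ H : ℝ → (E →L[ℂ] F), ContinuousWithinAt H s t₀ ∧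
      IsCompactOperator ⇑(H t₀) ∧ ∀ᶠ t in 𝓝[s] t₀, ‖A t - H t‖ ≤ ε) :
    ContinuousOn A s ∧ ∀ t ∈ s, IsCompactOperator ⇑(A t) := by
  constructor
  · intro t₀ ht₀
    refine continuousWithinAt_of_locally_uniform_approx_of_continuousWithinAt ht₀ ?_
    intro u hu
    obtain ⟨ε, hε, hu⟩ := Metric.mem_uniformity_dist.1 hu
    obtain ⟨H, h1, -, h3⟩ := h t₀ ht₀ (ε / 2) (by positivity)
    refine ⟨_, h3, H, h1, fun y hy => hu ?_⟩
    rw [dist_eq_norm]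
    have : ‖A y - H y‖ ≤ ε / 2 := hy
    linarith
  · intro t₀ ht₀
    refine compact_of_approx _ fun ε hε => ?_
    obtain ⟨H, -, h2, h3⟩ := h t₀ ht₀ ε hε
    exact ⟨H t₀, h2, h3.self_of_nhdsWithin ht₀⟩

end GeneralLemmas

namespace MRSetting

variable (M : MRSetting X X₀)

theorem int_cont (f : ℝ → X) (hf : ContinuousOn f (Ici 0)) (τ : ℝ) :
    ContinuousOn (fun s => M.S (τ - s) (f s)) (Icc 0 τ) :=
  sc_apply M.S M.S_cont f (fun s => τ - s) _ (hf.mono Icc_subset_Ici_self)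
    (by fun_prop) (fun s hs => by simpa using hs.2)

theorem SD_eq (f : ℝ → X) (hf : ContinuousOn f (Ici 0)) (t : ℝ) (ht : 0 ≤ t) (v : X₀)
    (h : HasDerivWithinAt (fun τ : ℝ => ∫ s in (0:ℝ)..τ, M.S (τ - s) (f s)) v (Ici 0) t) :
    M.SD f t = v :=
  UniqueDiffWithinAt.eq_deriv _ (uniqueDiffOn_Ici (0:ℝ) t ht) (M.SD_deriv f hf t ht) h

theorem SD_add_s8 (f g : ℝ → X) (hf : ContinuousOn f (Ici 0)) (hg : ContinuousOn g (Ici 0))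
    (t : ℝ) (ht : 0 ≤ t) : M.SD (fun s => f s + g s) t = M.SD f t + M.SD g t := by
  refine M.SD_eq _ (hf.add hg) t ht _ ?_
  refine ((M.SD_deriv f hf t ht).add (M.SD_deriv g hg t ht)).congr_of_mem ?_ ht
  intro τ hτ
  simp only [Pi.add_apply, map_add]
  exact intervalIntegral.integral_add
    ((M.int_cont f hf τ).intervalIntegrable_of_Icc hτ)
    ((M.int_cont g hg τ).intervalIntegrable_of_Icc hτ)

theorem SD_smul (c : ℂ) (f : ℝ → X) (hf : ContinuousOn f (Ici 0))
    (t : ℝ) (ht : 0 ≤ t) : M.SD (fun s => c • f s) t = c • M.SD f t := by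
  refine M.SD_eq _ (hf.const_smul c) t ht _ ?_
  refine ((M.SD_deriv f hf t ht).const_smul c).congr_of_mem ?_ ht
  intro τ hτ
  simp only [Pi.smul_apply, map_smul]
  exact intervalIntegral.integral_smul _ _

theorem SD_bd (f : ℝ → X) (hf : ContinuousOn f (Ici 0)) (t : ℝ) (ht : 0 ≤ t) (C : ℝ)
    (hC : ∀ s ∈ Icc 0 t, ‖f s‖ ≤ C) : ‖M.SD f t‖ ≤ M.δ t * C := by
  refine (M.SD_bound f hf t ht).trans (mul_le_mul_of_nonneg_left ?_ (M.δ_nonneg t ht))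
  have : Nonempty (Icc 0 t) := ⟨⟨0, le_rfl, ht⟩⟩
  exact ciSup_le fun s => hC s s.2

theorem δ_zero : M.δ 0 = 0 := by
  refine le_antisymm ?_ (M.δ_nonneg 0 le_rfl)
  refine ge_of_tendsto M.δ_lim ?_
  filter_upwards [self_mem_nhdsWithin] with t ht
  exact M.δ_mono self_mem_Ici (mem_Ici.2 (le_of_lt ht)) (le_of_lt ht)

theorem SD_zero_s8 (f : ℝ → X) (hf : ContinuousOn f (Ici 0)) : M.SD f 0 = 0 := by
  have := M.SD_bound f hf 0 self_mem_Ici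
  rw [M.δ_zero, zero_mul] at this
  simpa using this

theorem shift_cont {Y : Type*} [TopologicalSpace Y] (f : ℝ → Y) (hf : ContinuousOn f (Ici 0))
    (r : ℝ) (hr : 0 ≤ r) : ContinuousOn (fun s => f (r + s)) (Ici 0) :=
  hf.comp (by fun_prop) (fun s hs => add_nonneg hr hs)

theorem int_split (f : ℝ → X) (hf : ContinuousOn f (Ici 0)) (r h : ℝ) (hr : 0 ≤ r)
    (hh : 0 ≤ h) :
    ∫ s in (0:ℝ)..(r + h), M.S (r + h - s) (f s) =
      M.T h (∫ s in (0:ℝ)..r, M.S (r - s) (f s)) + M.S h (∫ s in (0:ℝ)..r, f s) +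
      ∫ s in (0:ℝ)..h, M.S (h - s) (f (r + s)) := by
  have : CompleteSpace X₀ := M.closed.completeSpace_coe
  have hc := M.int_cont f hf (r + h)
  have h1 : IntervalIntegrable (fun s => M.S (r + h - s) (f s)) volume 0 r :=
    (hc.mono (Icc_subset_Icc_right (by linarith))).intervalIntegrable_of_Icc hr
  have h2 : IntervalIntegrable (fun s => M.S (r + h - s) (f s)) volume r (r + h) :=
    (hc.mono (Icc_subset_Icc_left hr)).intervalIntegrable_of_Icc (by linarith)
  have h3 : IntervalIntegrable (fun s => M.S (r - s) (f s)) volume 0 r :=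
    (M.int_cont f hf r).intervalIntegrable_of_Icc hr
  have h4 : IntervalIntegrable f volume 0 r :=
    (hf.mono Icc_subset_Ici_self).intervalIntegrable_of_Icc hr
  rw [← intervalIntegral.integral_add_adjacent_intervals h1 h2]
  congr 1
  · rw [← ContinuousLinearMap.intervalIntegral_comp_comm _ h3,
      ← ContinuousLinearMap.intervalIntegral_comp_comm _ h4]
    have h5 : IntervalIntegrable (fun s => M.T h (M.S (r - s) (f s))) volume 0 r :=
      ((M.T h).continuous.comp_continuousOn (M.int_cont f hf r)).intervalIntegrable_of_Icc hr
    have h6 : IntervalIntegrable (fun s => M.S h (f s)) volume 0 r :=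
      ((M.S h).continuous.comp_continuousOn (hf.mono Icc_subset_Ici_self)).intervalIntegrable_of_Icc
        hr
    rw [← intervalIntegral.integral_add h5 h6]
    refine intervalIntegral.integral_congr fun s hs => ?_
    rw [uIcc_of_le hr] at hs
    have := M.TS h (r - s) hh (by linarith [hs.2]) (f s)
    simp only [this]
    rw [sub_add_cancel]
    congr 2
    ring
  · have := intervalIntegral.integral_comp_add_left (a := 0) (b := h)
      (fun s => M.S (r + h - s) (f s)) r
    rw [add_zero] at this
    rw [← this]
    refine intervalIntegral.integral_congr fun s hs => ?_
    have e1 : r + h - (r + s) = h - s := by ring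
    simp only [e1]

theorem SD_split (f : ℝ → X) (hf : ContinuousOn f (Ici 0)) (r h : ℝ) (hr : 0 ≤ r)
    (hh : 0 ≤ h) :
    M.SD f (r + h) = M.T h (M.SD f r) + M.SD (fun s => f (r + s)) h := by
  have hf' := shift_cont f hf r hr
  set y : X := ∫ s in (0:ℝ)..r, f s with hy
  set z : X₀ := ∫ s in (0:ℝ)..r, M.S (r - s) (f s) with hz
  set g : ℝ → X₀ := fun h => M.T h z + M.S h y with hg
  -- derivative of g on Ici 0
  have hgd : ∀ k : ℝ, 0 ≤ k →
      HasDerivWithinAt g (M.SD f (r + k) - M.SD (fun s => f (r + s)) k) (Ici 0) k := by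
    intro k hk
    have hA : HasDerivWithinAt (fun τ : ℝ => ∫ s in (0:ℝ)..(r + τ), M.S (r + τ - s) (f s))
        (M.SD f (r + k)) (Ici 0) k := by
      have := HasDerivWithinAt.scomp (h := fun τ : ℝ => r + τ) (h' := 1) (s := Ici 0) k
        (M.SD_deriv f hf (r + k) (add_nonneg hr hk))
        ((hasDerivWithinAt_id k _).const_add r) (fun s hs => add_nonneg hr hs)
      simpa [Function.comp_def] using this
    refine (hA.sub (M.SD_deriv _ hf' k hk)).congr_of_mem ?_ hk
    intro τ hτ
    simp only [Pi.sub_apply, M.int_split f hf r τ hr hτ, hg, add_sub_cancel_right, hy, hz]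
  have hg0 : HasDerivWithinAt g (M.SD f r) (Ici 0) 0 := by
    have := hgd 0 le_rfl
    rwa [M.SD_zero_s8 _ hf', add_zero, sub_zero] at this
  have hgT : HasDerivWithinAt g (M.T h (M.SD f r)) (Ici h) h := by
    have h1 : HasDerivWithinAt (fun k => g (k - h)) (M.SD f r) (Ici h) h := by
      have hg0' : HasDerivWithinAt g (M.SD f r) (Ici 0) (h - h) := by rwa [sub_self]
      have := HasDerivWithinAt.scomp (h := fun τ : ℝ => τ - h) (h' := 1) (s := Ici h) h
        hg0' ((hasDerivWithinAt_id h _).sub_const h) (fun s hs => mem_Ici.2 (sub_nonneg.2 hs))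
      simpa [Function.comp_def] using this
    have h2 : HasDerivWithinAt (fun k => M.T h (g (k - h))) (M.T h (M.SD f r)) (Ici h) h :=
      ((M.T h).restrictScalars ℝ).hasFDerivAt.comp_hasDerivWithinAt h h1
    refine (h2.add_const (M.S h y)).congr_of_mem ?_ self_mem_Ici
    intro k hk
    have hk' : 0 ≤ k - h := sub_nonneg.2 hk
    have e : k = h + (k - h) := by ring
    simp only [hg, map_add, M.TS h (k - h) hh hk' y]
    rw [← e]
    conv_lhs => rw [e, M.T_add h (k - h) hh hk']
    simp only [ContinuousLinearMap.comp_apply]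
    rw [← e]
    abel
  have := UniqueDiffWithinAt.eq_deriv _ (uniqueDiffOn_Ici h h self_mem_Ici)
    ((hgd h hh).mono (Ici_subset_Ici.2 hh)) hgT
  rw [← this]
  abel

theorem SDop_split (V : ℝ → (X₀ →L[ℂ] X)) (hV : ∀ x : X₀, ContinuousOn (fun s => V s x) (Ici 0))
    (r h : ℝ) (hr : 0 ≤ r) (hh : 0 ≤ h) :
    M.SDop V (r + h) = (M.T h).comp (M.SDop V r) + M.SDop (fun s => V (r + s)) h := by
  ext1 x
  have hV' : ∀ x : X₀, ContinuousOn (fun s => V (r + s) x) (Ici 0) := fun x =>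
    shift_cont (fun s => V s x) (hV x) r hr
  simp only [add_apply, ContinuousLinearMap.comp_apply, M.SDop_apply V hV,
    M.SDop_apply _ hV']
  exact M.SD_split _ (hV x) r h hr hh

theorem SDop_bd (V : ℝ → (X₀ →L[ℂ] X)) (hV : ∀ x : X₀, ContinuousOn (fun s => V s x) (Ici 0))
    (t : ℝ) (ht : 0 ≤ t) (C : ℝ) (hC0 : 0 ≤ C) (hC : ∀ s ∈ Icc 0 t, ‖V s‖ ≤ C) :
    ‖M.SDop V t‖ ≤ M.δ t * C := by
  refine ContinuousLinearMap.opNorm_le_bound _ (mul_nonneg (M.δ_nonneg t ht) hC0) fun x => ?_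
  rw [M.SDop_apply V hV, mul_assoc]
  exact M.SD_bd _ (hV x) t ht _ fun s hs => (V s).le_of_opNorm_le (hC s hs) x

theorem SDop_add (V W : ℝ → (X₀ →L[ℂ] X)) (hV : ∀ x : X₀, ContinuousOn (fun s => V s x) (Ici 0))
    (hW : ∀ x : X₀, ContinuousOn (fun s => W s x) (Ici 0)) (t : ℝ) (ht : 0 ≤ t) :
    M.SDop (V + W) t = M.SDop V t + M.SDop W t := by
  ext1 x
  have hVW : ∀ x : X₀, ContinuousOn (fun s => (V + W) s x) (Ici 0) := fun x =>
    (hV x).add (hW x)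
  simp only [add_apply, M.SDop_apply V hV, M.SDop_apply W hW,
    M.SDop_apply _ hVW]
  exact M.SD_add_s8 _ _ (hV x) (hW x) t ht

/-- Families for which the conclusion holds on `[0,∞)`. -/
def Good (W : ℝ → (X₀ →L[ℂ] X)) : Prop :=
  (∀ x : X₀, ContinuousOn (fun s => W s x) (Ici 0)) ∧ ContinuousOn (M.SDop W) (Ici 0) ∧
    ∀ t : ℝ, 0 ≤ t → IsCompactOperator ⇑(M.SDop W t)

theorem good_add (V W : ℝ → (X₀ →L[ℂ] X)) (hV : M.Good V) (hW : M.Good W) : M.Good (V + W) := by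
  refine ⟨fun x => (hV.1 x).add (hW.1 x), ?_, fun t ht => ?_⟩
  · exact (hV.2.1.add hW.2.1).congr fun t ht => M.SDop_add V W hV.1 hW.1 t ht
  · rw [M.SDop_add V W hV.1 hW.1 t ht]
    exact (hV.2.2 t ht).add (hW.2.2 t ht)

theorem good_smul (φ : ℝ → ℂ) (hφ : Continuous φ) (K : X₀ →L[ℂ] X) (hK : IsCompactOperator ⇑K) :
    M.Good (fun s => φ s • K) := by
  have : CompleteSpace X₀ := M.closed.completeSpace_coe
  have hc : ∀ y : X, ContinuousOn (fun s => φ s • y) (Ici 0) := fun y => by fun_prop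
  have hW : ∀ x : X₀, ContinuousOn (fun s => (φ s • K) x) (Ici 0) := fun x => hc (K x)
  have hΦ : ∀ t : ℝ, ∃ Φ : X →L[ℂ] X₀, 0 ≤ t → ∀ y, Φ y = M.SD (fun s => φ s • y) t := by
    intro t
    by_cases ht : 0 ≤ t
    · obtain ⟨C, hC⟩ := (isCompact_Icc (a := (0:ℝ)) (b := t)).exists_bound_of_continuousOn
        hφ.continuousOn
      refine ⟨LinearMap.mkContinuous
        { toFun := fun y => M.SD (fun s => φ s • y) t
          map_add' := fun y z => ?_
          map_smul' := fun c y => ?_ } (M.δ t * C) fun y => ?_, fun _ y => rfl⟩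
      · simp only [smul_add]
        exact M.SD_add_s8 _ _ (hc y) (hc z) t ht
      · simp only [RingHom.id_apply, smul_comm _ c]
        exact M.SD_smul c _ (hc y) t ht
      · rw [mul_assoc]
        refine M.SD_bd _ (hc y) t ht _ fun s hs => ?_
        rw [norm_smul]
        exact mul_le_mul_of_nonneg_right (hC s hs) (norm_nonneg _)
    · exact ⟨0, fun h => absurd h ht⟩
  choose Φ hΦ using hΦ
  have hΦc : ∀ y : X, ContinuousOn (fun t => Φ t y) (Ici 0) := fun y =>
    (M.SD_cont _ (hc y)).congr fun t ht => hΦ t ht y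
  have hEq : ∀ t : ℝ, 0 ≤ t → M.SDop (fun s => φ s • K) t = (Φ t).comp K := by
    intro t ht
    ext1 x
    rw [M.SDop_apply _ hW, ContinuousLinearMap.comp_apply, hΦ t ht]
    rfl
  refine ⟨hW, (comp_compact Φ hΦc K hK).congr fun t ht => hEq t ht, fun t ht => ?_⟩
  rw [hEq t ht]
  exact hK.clm_comp (Φ t)

theorem good_core (W : ℝ → (X₀ →L[ℂ] X)) (hW : ContinuousOn W (Ici 0))
    (hK : ∀ t : ℝ, 0 ≤ t → IsCompactOperator ⇑(W t)) : M.Good W := by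
  have : CompleteSpace X₀ := M.closed.completeSpace_coe
  have hWs : ∀ x : X₀, ContinuousOn (fun s => W s x) (Ici 0) := fun x =>
    hW.clm_apply continuousOn_const
  refine ⟨hWs, good_of_approx _ _ fun t₀ ht₀ ε hε => ?_⟩
  have ht₀' : 0 ≤ t₀ := ht₀
  set a : ℝ := t₀ + 1 with ha
  have ha0 : 0 < a := by positivity
  set e : ℝ := ε / (M.δ a + 1) with he
  have hδ := M.δ_nonneg a ha0.le
  have he0 : 0 < e := by positivity
  let f : C(unitInterval, X₀ →L[ℂ] X) := ⟨fun u => W (a * u), by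
    refine hW.comp_continuous (by fun_prop) fun u => mul_nonneg ha0.le u.2.1⟩
  obtain ⟨n, hn⟩ := bern_approx (E := X₀ →L[ℂ] X) f e he0
  let φ : Fin (n + 1) → ℝ → ℂ := fun k s =>
    (((n.choose k : ℝ) * (s / a) ^ (k : ℕ) * (1 - s / a) ^ (n - k) : ℝ) : ℂ)
  let Z : ℝ → (X₀ →L[ℂ] X) := ∑ k : Fin (n + 1), fun s => φ k s • f (bernstein.z k)
  have hZ : M.Good Z := by
    refine Finset.sum_induction _ M.Good (fun V W hV hW => M.good_add V W hV hW) ?_ ?_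
    · have := M.good_smul (fun _ => 0) continuous_const 0 isCompactOperator_zero
      convert this using 1
      ext; simp
    · intro k _
      refine M.good_smul (φ k) (by fun_prop) _ ?_
      exact hK _ (mul_nonneg ha0.le (bernstein.z k).2.1)
  have hZW : ∀ s ∈ Icc 0 a, ‖W s - Z s‖ ≤ e := by
    intro s hs
    let u : unitInterval := ⟨s / a, div_nonneg hs.1 ha0.le, (div_le_one ha0).2 hs.2⟩
    have h1 : Z s = ∑ k : Fin (n + 1), ((bernstein n k u : ℝ) : ℂ) • f (bernstein.z k) := by
      simp only [Z, Finset.sum_apply, bernstein_apply]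
      rfl
    have h2 : W s = f u := by
      change W s = W (a * (s / a))
      rw [mul_div_cancel₀ _ ha0.ne']
    rw [h1, h2]
    exact hn u
  refine ⟨M.SDop Z, hZ.2.1 t₀ ht₀, hZ.2.2 t₀ ht₀, ?_⟩
  have h2 : ∀ᶠ t in 𝓝[Ici 0] t₀, t < a :=
    nhdsWithin_le_nhds (Iio_mem_nhds (by linarith))
  filter_upwards [h2, self_mem_nhdsWithin] with t hta ht
  have hD : ∀ x : X₀, ContinuousOn (fun s => (W s - Z s) x) (Ici 0) := fun x =>
    (hWs x).sub (hZ.1 x)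
  have hsum := M.SDop_add (fun s => W s - Z s) Z hD hZ.1 t ht
  have : (fun s => W s - Z s) + Z = W := by ext1 s; simp
  rw [this] at hsum
  rw [hsum, add_sub_cancel_right]
  refine (M.SDop_bd _ hD t ht e he0.le fun s hs => hZW s ⟨hs.1, hs.2.trans hta.le⟩).trans ?_
  have : M.δ t ≤ M.δ a := M.δ_mono ht ha0.le hta.le
  calc M.δ t * e ≤ (M.δ a + 1) * e := by gcongr; linarith
    _ = ε := by rw [he]; field_simp

theorem δ_small (c : ℝ) (hc : 0 < c) (ε : ℝ) (hε : 0 < ε) (b : ℝ) (hb : 0 < b) :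
    ∃ e, 0 < e ∧ e < b ∧ M.δ e * c ≤ ε := by
  have h1 : ∀ᶠ e in 𝓝[>] (0:ℝ), M.δ e < ε / c := M.δ_lim.eventually_lt_const (by positivity)
  have h2 : ∀ᶠ e in 𝓝[>] (0:ℝ), e < b := nhdsWithin_le_nhds (Iio_mem_nhds hb)
  obtain ⟨e, h1, h2, h3⟩ := (h1.and (h2.and self_mem_nhdsWithin)).exists
  exact ⟨e, h3, h2, ((lt_div_iff₀ hc).1 h1).le⟩

theorem part_a {Y : Type*} [NormedAddCommGroup Y] [NormedSpace ℂ Y] [CompleteSpace Y]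
    (V : ℝ → (X₀ →L[ℂ] X)) (hV : ∀ x : X₀, ContinuousOn (fun s => V s x) (Ici 0))
    (L : X₀ →L[ℂ] Y) (hL : ∀ t : ℝ, 0 < t → IsCompactOperator ⇑(L.comp (M.T t)))
    (t : ℝ) (ht : 0 < t) : IsCompactOperator ⇑(L.comp (M.SDop V t)) := by
  have : CompleteSpace X₀ := M.closed.completeSpace_coe
  obtain ⟨C, hC0, hC⟩ := sc_bdd V hV t
  refine compact_of_approx _ fun ε hε => ?_
  obtain ⟨e, he0, het, he⟩ := M.δ_small (C * (‖L‖ + 1)) (by positivity) ε hε t ht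
  refine ⟨(L.comp (M.T e)).comp (M.SDop V (t - e)), (hL e he0).comp_clm _, ?_⟩
  have hs := M.SDop_split V hV (t - e) e (by linarith) he0.le
  rw [sub_add_cancel] at hs
  have hV' : ∀ x : X₀, ContinuousOn (fun s => V (t - e + s) x) (Ici 0) := fun x =>
    shift_cont (fun s => V s x) (hV x) _ (by linarith)
  have hb := M.SDop_bd _ hV' e he0.le C hC0.le fun s hs =>
    hC _ ⟨by linarith [hs.1], by linarith [hs.2]⟩
  rw [hs, ContinuousLinearMap.comp_add, ContinuousLinearMap.comp_assoc, add_sub_cancel_left]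
  have hδ := M.δ_nonneg e he0.le
  calc _ ≤ ‖L‖ * ‖M.SDop (fun s => V (t - e + s)) e‖ := ContinuousLinearMap.opNorm_comp_le _ _
    _ ≤ (‖L‖ + 1) * (M.δ e * C) := by gcongr; linarith
    _ = M.δ e * (C * (‖L‖ + 1)) := by ring
    _ ≤ ε := he

theorem shift_good (V : ℝ → (X₀ →L[ℂ] X)) (β r : ℝ) (hr : β < r)
    (hc : ContinuousOn V (Ioi β)) (hK : ∀ t : ℝ, β < t → IsCompactOperator ⇑(V t)) :
    M.Good (fun s => V (r + s)) := by
  have hm : ∀ s : ℝ, 0 ≤ s → β < r + s := fun s hs => by linarith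
  exact M.good_core _ (hc.comp (by fun_prop) fun s hs => hm s hs) fun t ht => hK _ (hm t ht)

theorem part_b (V : ℝ → (X₀ →L[ℂ] X)) (hV : ∀ x : X₀, ContinuousOn (fun s => V s x) (Ici 0))
    (hc : ContinuousOn V (Ioi 0)) (hK : ∀ t : ℝ, 0 < t → IsCompactOperator ⇑(V t)) :
    ContinuousOn (M.SDop V) (Ioi 0) ∧ ∀ t ∈ Ioi (0:ℝ), IsCompactOperator ⇑(M.SDop V t) := by
  have : CompleteSpace X₀ := M.closed.completeSpace_coe
  refine good_of_approx _ _ fun t₀ ht₀ ε hε => ?_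
  have ht₀' : 0 < t₀ := ht₀
  obtain ⟨C, hC0, hC⟩ := sc_bdd V hV t₀
  obtain ⟨D, hD0, hD⟩ := sc_bdd M.T M.T_cont (t₀ + 1)
  obtain ⟨e, he0, het, he⟩ := M.δ_small (C * D) (by positivity) ε hε t₀ ht₀
  have hG := M.shift_good V 0 e he0 hc hK
  refine ⟨fun t => M.SDop (fun s => V (e + s)) (t - e), ?_, hG.2.2 _ (by linarith), ?_⟩
  · refine ContinuousAt.continuousWithinAt ?_
    have h1 : ContinuousAt (M.SDop (fun s => V (e + s))) (t₀ - e) :=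
      hG.2.1.continuousAt (Ici_mem_nhds (by linarith))
    exact ContinuousAt.comp (f := fun t => t - e) (x := t₀) h1 (by fun_prop)
  · have h2 : ∀ᶠ t in 𝓝[Ioi 0] t₀, t < t₀ + 1 :=
      nhdsWithin_le_nhds (Iio_mem_nhds (by linarith))
    have h3 : ∀ᶠ t in 𝓝[Ioi 0] t₀, e < t := nhdsWithin_le_nhds (Ioi_mem_nhds het)
    filter_upwards [h2, h3] with t ht1 hte
    have hs := M.SDop_split V hV e (t - e) he0.le (by linarith)
    rw [add_sub_cancel] at hs
    rw [hs, add_sub_cancel_right]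
    have hb := M.SDop_bd V hV e he0.le C hC0.le fun s hs => hC _ ⟨hs.1, hs.2.trans het.le⟩
    calc _ ≤ ‖M.T (t - e)‖ * ‖M.SDop V e‖ := ContinuousLinearMap.opNorm_comp_le _ _
      _ ≤ D * (M.δ e * C) := by
        gcongr
        exact hD _ ⟨by linarith, by linarith⟩
      _ = M.δ e * (C * D) := by ring
      _ ≤ ε := he

theorem part_c (V : ℝ → (X₀ →L[ℂ] X)) (hV : ∀ x : X₀, ContinuousOn (fun s => V s x) (Ici 0))
    (α β : ℝ) (hα : 0 ≤ α) (hβ : 0 ≤ β)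
    (hT : ∀ t : ℝ, α < t → IsCompactOperator ⇑(M.T t))
    (hc : ContinuousOn V (Ioi β)) (hK : ∀ t : ℝ, β < t → IsCompactOperator ⇑(V t)) :
    ContinuousOn (M.SDop V) (Ioi (α + β)) ∧
      ∀ t ∈ Ioi (α + β), IsCompactOperator ⇑(M.SDop V t) := by
  have : CompleteSpace X₀ := M.closed.completeSpace_coe
  refine good_of_approx _ _ fun t₀ ht₀ ε hε => ?_
  have ht₀' : α + β < t₀ := ht₀
  obtain ⟨r, hr1, hr2⟩ := exists_between (show β < t₀ - α by linarith)
  obtain ⟨a, ha1, ha2⟩ := exists_between (show α < t₀ - r by linarith)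
  have hG := M.shift_good V β r hr1 hc hK
  have hTa := comp_compact M.T M.T_cont (M.T a) (hT a ha1)
  refine ⟨fun t => ((M.T (t - r - a)).comp (M.T a)).comp (M.SDop V r) +
    M.SDop (fun s => V (r + s)) (t - r), ?_, ?_, ?_⟩
  · refine ContinuousAt.continuousWithinAt ?_
    have h1 : ContinuousAt (M.SDop (fun s => V (r + s))) (t₀ - r) :=
      hG.2.1.continuousAt (Ici_mem_nhds (by linarith))
    have h2 : ContinuousAt (fun t => (M.T t).comp (M.T a)) (t₀ - r - a) :=
      hTa.continuousAt (Ici_mem_nhds (by linarith))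
    have h3 := ContinuousAt.comp (f := fun t => t - r) (x := t₀) h1 (by fun_prop)
    have h4 := ContinuousAt.comp (f := fun t => t - r - a) (x := t₀) h2 (by fun_prop)
    exact (h4.clm_comp continuousAt_const).add h3
  · exact (((hT a ha1).clm_comp (M.T (t₀ - r - a))).comp_clm (M.SDop V r)).add
      (hG.2.2 _ (by linarith))
  · have h3 : ∀ᶠ t in 𝓝[Ioi (α + β)] t₀, r + a < t :=
      nhdsWithin_le_nhds (Ioi_mem_nhds (by linarith))
    filter_upwards [h3] with t ht
    have hs := M.SDop_split V hV r (t - r) (by linarith) (by linarith)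
    have hTT := M.T_add (t - r - a) a (by linarith) (by linarith)
    rw [sub_add_cancel] at hTT
    rw [add_sub_cancel] at hs
    rw [hs, hTT, sub_self, norm_zero]
    exact hε.le

end MRSetting

/-- compactness of `S ⋄ V`. -/
theorem diamond_compactness (M : MRSetting X X₀)
    (V : ℝ → (X₀ →L[ℂ] X)) (hV : ∀ x : X₀, ContinuousOn (fun s => V s x) (Ici 0))
    (α β : ℝ) (hα : 0 ≤ α) (hβ : 0 ≤ β) :
    (((∀ t : ℝ, 0 < t → IsCompactOperator ⇑(M.T t)) →
        ∀ t : ℝ, 0 < t → IsCompactOperator ⇑(M.SDop V t)) ∧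
     (∀ L : X₀ →L[ℂ] X, (∀ t : ℝ, 0 < t → IsCompactOperator ⇑(L.comp (M.T t))) →
        ∀ t : ℝ, 0 < t → IsCompactOperator ⇑(L.comp (M.SDop V t)))) ∧
    (ContinuousOn V (Ioi 0) → (∀ t : ℝ, 0 < t → IsCompactOperator ⇑(V t)) →
      ContinuousOn (M.SDop V) (Ioi 0) ∧
        ∀ t : ℝ, 0 < t → IsCompactOperator ⇑(M.SDop V t)) ∧
    ((∀ t : ℝ, α < t → IsCompactOperator ⇑(M.T t)) →
      ContinuousOn V (Ioi β) → (∀ t : ℝ, β < t → IsCompactOperator ⇑(V t)) →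
      ContinuousOn (M.SDop V) (Ioi (α + β)) ∧
        ∀ t : ℝ, α + β < t → IsCompactOperator ⇑(M.SDop V t)) := by
  refine ⟨⟨fun hT t ht => ?_, fun L hL t ht => M.part_a V hV L hL t ht⟩, ?_, ?_⟩
  · haveI : CompleteSpace X₀ := M.closed.completeSpace_coe
    exact M.part_a V hV (ContinuousLinearMap.id ℂ X₀) hT t ht
  · intro hc hK
    exact M.part_b V hV hc hK
  · intro hT hc hK
    exact M.part_c V hV α β hα hβ hT hc hK

end
end
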